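/- arXiv:math/9802088 — 8 statements merged into one kernel-verified Lean document; each statement's English description precedes it below -/
import Mathlib

section
/- A pair of maps L : G^∨ → Λ, D : G → Λ satisfies the cover condition if and only if L_0 = 0, D_0 = 0 and for every k ≥ 0 and every k-tuple χ_1, …, χ_k ∈ G^∨ one has L_{χ_1} + ⋯ + L_{χ_k} = L_{χ_1 + ⋯ + χ_k} + Σ_{σ ∈ G} ⌊(1/2) Σ_{j=1}^{k} i(χ_j(σ))⌋ · D_σ, where i : ℤ/2 → ℤ sends 0 to 0 and 1 to 1, ⌊·⌋ denotes the integer part, and the coefficient ⌊(1/2) Σ_j i(χ_j(σ))⌋ acts by integer scalar multiplication on Λ. -/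
/-- The cover condition for a pair of maps `L : G^∨ → Λ`, `D : G → Λ`, where
`G = (ℤ/2)^r` is viewed as a vector space over `ℤ/2` and `G^∨` is its dual:
`L 0 = 0`, `D 0 = 0` and for all `χ, η ∈ G^∨`,
`L χ + L η = L (χ+η) + Σ_{σ : χ(σ)=η(σ)=1} D σ`. -/
def CoverCondition {r : ℕ} {Λ : Type*} [AddCommGroup Λ]
    (L : Module.Dual (ZMod 2) (Fin r → ZMod 2) → Λ)
    (D : (Fin r → ZMod 2) → Λ) : Prop :=
  L 0 = 0 ∧ D 0 = 0 ∧ ∀ χ η : Module.Dual (ZMod 2) (Fin r → ZMod 2),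
    L χ + L η = L (χ + η) +
      ∑ σ : Fin r → ZMod 2, if χ σ = 1 ∧ η σ = 1 then D σ else 0

/-- Adding one bit `b` to an integer `n` increases `⌊n / 2⌋` exactly when `n` is odd and
`b = 1`. -/
theorem ediv_two_add_zmod_val (n : ℤ) (a b : ZMod 2) (h : (n : ZMod 2) = a) :
    (n + (b.val : ℤ)) / 2 = n / 2 + if a = 1 ∧ b = 1 then 1 else 0 := by
  subst h
  have hb : b = 0 ∨ b = 1 := by
    revert b
    decide
  have h2 : (2 : ZMod 2) = 0 := rfl
  have h1 : (1 : ZMod 2).val = 1 := rfl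
  rcases Int.even_or_odd' n with ⟨m, rfl | rfl⟩ <;> rcases hb with rfl | rfl <;>
    simp [h1, h2] <;> omega

/-- `(L, D)` satisfies the cover condition iff `L 0 = 0`, `D 0 = 0` and
for every `k ≥ 0` and every `k`-tuple `χ_1, …, χ_k` of elements of `G^∨`,
`Σ_j L (χ_j) = L (Σ_j χ_j) + Σ_σ ⌊(1/2) Σ_j i(χ_j σ)⌋ • D σ`, where `i : ℤ/2 → ℤ`
sends `0 ↦ 0`, `1 ↦ 1`. -/
theorem cover_condition_iff_multi {r : ℕ} {Λ : Type*} [AddCommGroup Λ]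
    (L : Module.Dual (ZMod 2) (Fin r → ZMod 2) → Λ)
    (D : (Fin r → ZMod 2) → Λ) :
    CoverCondition L D ↔
      (L 0 = 0 ∧ D 0 = 0 ∧
        ∀ (k : ℕ) (χ : Fin k → Module.Dual (ZMod 2) (Fin r → ZMod 2)),
          ∑ j, L (χ j) = L (∑ j, χ j) +
            ∑ σ : Fin r → ZMod 2,
              ((∑ j, ((χ j σ).val : ℤ)) / 2) • D σ) := by
  refine and_congr_right fun hL => and_congr_right fun _ => ⟨fun h k χ => ?_, fun h χ η => ?_⟩
  · induction k with
    | zero => simp [hL]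
    | succ k ih =>
      rw [Fin.sum_univ_castSucc, ih, add_right_comm, h, Fin.sum_univ_castSucc χ, add_assoc,
        ← Finset.sum_add_distrib]
      congr 1
      refine Finset.sum_congr rfl fun σ _ => ?_
      rw [Fin.sum_univ_castSucc, ediv_two_add_zmod_val _ ((∑ j : Fin k, χ j.castSucc) σ) _
        (by simp [LinearMap.sum_apply]), add_smul, ite_smul, one_smul, zero_smul, add_comm]
  · have h2 := h 2 ![χ, η]
    simp only [Fin.sum_univ_two, Matrix.cons_val_zero, Matrix.cons_val_one] at h2
    rw [h2]
    congr 1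
    refine Finset.sum_congr rfl fun σ _ => ?_
    rw [ediv_two_add_zmod_val _ (χ σ) _ (by simp)]
    have hv : ((χ σ).val : ℤ) / 2 = 0 := by
      have := ZMod.val_lt (χ σ)
      omega
    rw [hv, zero_add, ite_smul, one_smul, zero_smul]
end

section
/- (Lemma 3.1) Let α : Λ̃ → Λ be a homomorphism of abelian groups whose kernel is uniquely divisible (i.e. a ℚ-vector space: for every x ∈ ker α and every nonzero integer n there is a unique y ∈ ker α with n·y = x) and whose cokernel Λ / im(α) is torsion free. Then for every pair (L, D) ∈ Z(G, Λ) and every map D̃ : G → Λ̃ with D̃_0 = 0 and α ∘ D̃ = D, there exists a unique map L̃ : G^∨ → Λ̃ with α ∘ L̃ = L such that the pair (L̃, D̃) satisfies the cover condition, i.e. (L̃, D̃) ∈ Z(G, Λ̃). -/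
/-- The sums of `D` over `{χ = 1}` satisfy the doubled cover condition. -/
theorem sum_support_add_sum_support {r : ℕ} {M : Type*} [AddCommGroup M]
    (D : (Fin r → ZMod 2) → M) (χ η : Module.Dual (ZMod 2) (Fin r → ZMod 2)) :
    (∑ σ, if χ σ = 1 then D σ else 0) + (∑ σ, if η σ = 1 then D σ else 0) =
      (∑ σ, if (χ + η) σ = 1 then D σ else 0) +
        (2 : ℤ) • ∑ σ, if χ σ = 1 ∧ η σ = 1 then D σ else 0 := by
  rw [Finset.smul_sum, ← Finset.sum_add_distrib, ← Finset.sum_add_distrib]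
  refine Finset.sum_congr rfl fun σ _ => ?_
  have zero_or_one : ∀ a : ZMod 2, a = 0 ∨ a = 1 := by decide
  have one_add_one : (1 : ZMod 2) + 1 = 0 := by decide
  rcases zero_or_one (χ σ) with h | h <;> rcases zero_or_one (η σ) with k | k <;>
    simp [h, k, one_add_one, two_zsmul]

/-- The diagonal case of the cover condition. -/
theorem CoverCondition.two_zsmul_eq {r : ℕ} {M : Type*} [AddCommGroup M]
    {L : Module.Dual (ZMod 2) (Fin r → ZMod 2) → M} {D : (Fin r → ZMod 2) → M}
    (h : CoverCondition L D) (χ : Module.Dual (ZMod 2) (Fin r → ZMod 2)) :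
    (2 : ℤ) • L χ = ∑ σ, if χ σ = 1 then D σ else 0 := by
  have add_self_eq : χ + χ = 0 := by
    ext i
    exact CharTwo.add_self_eq_zero _
  have key := h.2.2 χ χ
  rw [add_self_eq, h.1, zero_add] at key
  simpa [two_zsmul] using key

/-- Lemma 3.1: let `α : Λ̃ → Λ` be a homomorphism of abelian groups whose
kernel is uniquely divisible and whose cokernel is torsion free.  Then for every pair
`(L, D)` satisfying the cover condition and every lifting `D̃` of `D` with `D̃ 0 = 0`,
there is a unique lifting `L̃` of `L` such that `(L̃, D̃)` satisfies the cover condition. -/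
theorem exists_unique_lift_cover_condition {r : ℕ}
    {Λ' Λ : Type*} [AddCommGroup Λ'] [AddCommGroup Λ]
    (α : Λ' →+ Λ)
    (hker : ∀ x : Λ', α x = 0 → ∀ n : ℤ, n ≠ 0 →
      ∃! y : Λ', α y = 0 ∧ n • y = x)
    (hcoker : ∀ (v : Λ) (n : ℤ), n ≠ 0 → (n • v) ∈ Set.range α → v ∈ Set.range α)
    (L : Module.Dual (ZMod 2) (Fin r → ZMod 2) → Λ)
    (D : (Fin r → ZMod 2) → Λ)
    (hLD : CoverCondition L D)
    (D' : (Fin r → ZMod 2) → Λ')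
    (hD'0 : D' 0 = 0) (hD' : ∀ σ, α (D' σ) = D σ) :
    ∃! L' : Module.Dual (ZMod 2) (Fin r → ZMod 2) → Λ',
      (∀ χ, α (L' χ) = L χ) ∧ CoverCondition L' D' := by
  have eq_zero_of_two : ∀ x : Λ', α x = 0 → (2 : ℤ) • x = 0 → x = 0 := fun x hx h2 =>
    (hker 0 (map_zero α) 2 two_ne_zero).unique ⟨hx, h2⟩ ⟨map_zero α, smul_zero _⟩
  have exists_half : ∀ χ, ∃ x : Λ', α x = L χ ∧
      (2 : ℤ) • x = ∑ σ, if χ σ = 1 then D' σ else 0 := by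
    intro χ
    have map_sum_eq : α (∑ σ, if χ σ = 1 then D' σ else 0) = (2 : ℤ) • L χ := by
      rw [hLD.two_zsmul_eq, map_sum]
      exact Finset.sum_congr rfl fun σ _ => by split_ifs <;> simp [hD']
    obtain ⟨x, hx⟩ := hcoker (L χ) 2 two_ne_zero ⟨_, map_sum_eq⟩
    obtain ⟨y, ⟨hy, h2⟩, -⟩ := hker ((2 : ℤ) • x - ∑ σ, if χ σ = 1 then D' σ else 0)
      (by rw [map_sub, map_zsmul, hx, map_sum_eq, sub_self]) 2 two_ne_zero
    refine ⟨x - y, by rw [map_sub, hx, hy, sub_zero], ?_⟩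
    rw [smul_sub, h2, sub_sub_cancel]
  choose L' hL' two_L' using exists_half
  refine ⟨L', ⟨hL', ?_, hD'0, fun χ η => ?_⟩, fun M hM => funext fun χ => ?_⟩
  · exact eq_zero_of_two _ (by rw [hL', hLD.1]) (by simp [two_L'])
  · rw [← sub_eq_zero]
    refine eq_zero_of_two _ ?_ ?_
    · have map_sum_eq : α (∑ σ, if χ σ = 1 ∧ η σ = 1 then D' σ else 0) =
          ∑ σ, if χ σ = 1 ∧ η σ = 1 then D σ else 0 := by
        rw [map_sum]
        exact Finset.sum_congr rfl fun σ _ => by split_ifs <;> simp [hD']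
      rw [map_sub, map_add, map_add, hL', hL', hL', map_sum_eq, hLD.2.2, sub_self]
    · rw [smul_sub, smul_add, smul_add, two_L', two_L', two_L',
        sum_support_add_sum_support, sub_self]
  · rw [← sub_eq_zero]
    exact eq_zero_of_two _ (by rw [map_sub, hM.1, hL', sub_self])
      (by rw [smul_sub, hM.2.two_zsmul_eq, two_L', sub_self])
end

section
/- Let H ⊆ G be a subspace of dimension 1 and let v ∈ Λ. Define L : G^∨ → Λ by L_χ = 0 if χ vanishes identically on H and L_χ = v otherwise, and define D : G → Λ by D_σ = 2v if σ ∈ H \ {0} and D_σ = 0 otherwise. Then the pair (L, D) satisfies the cover condition, i.e. (L, D) ∈ Z(G, Λ). -/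
open scoped Classical in
/-- for a one-dimensional subspace `H ⊆ G` and `v ∈ Λ`, the elementary
pair `L_χ = 0` if `χ|_H = 0`, `L_χ = v` otherwise; `D_σ = 2v` for `σ ∈ H \ {0}`,
`D_σ = 0` otherwise, satisfies the cover condition. -/
theorem elementary_solution_dim_one {r : ℕ} {Λ : Type*} [AddCommGroup Λ]
    (H : Submodule (ZMod 2) (Fin r → ZMod 2))
    (hH : Module.finrank (ZMod 2) H = 1) (v : Λ) :
    CoverCondition
      (fun χ : Module.Dual (ZMod 2) (Fin r → ZMod 2) =>
        if ∀ σ ∈ H, χ σ = 0 then (0 : Λ) else v)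
      (fun σ : Fin r → ZMod 2 =>
        if σ ∈ H ∧ σ ≠ 0 then (2 : ℤ) • v else 0) := by
  obtain ⟨⟨h, hmem⟩, hne, hspan⟩ := finrank_eq_one_iff'.mp hH
  have hh : h ≠ 0 := fun e => hne (Subtype.ext e)
  have two : ∀ a : ZMod 2, a = 0 ∨ a = 1 := by decide
  have mem_iff : ∀ σ, σ ∈ H ∧ σ ≠ 0 ↔ σ = h := by
    refine fun σ => ⟨fun ⟨hσ, hσ0⟩ => ?_, fun e => e ▸ ⟨hmem, hh⟩⟩
    obtain ⟨c, hc⟩ := hspan ⟨σ, hσ⟩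
    have hc' : c • h = σ := congrArg Subtype.val hc
    rcases two c with rfl | rfl
    · exact absurd (by simpa using hc'.symm) hσ0
    · simpa using hc'.symm
  have vanish_iff : ∀ χ : Module.Dual (ZMod 2) (Fin r → ZMod 2),
      (∀ σ ∈ H, χ σ = 0) ↔ χ h = 0 := by
    refine fun χ => ⟨fun H0 => H0 h hmem, fun h0 σ hσ => ?_⟩
    by_cases hσ0 : σ = 0
    · simp [hσ0]
    · rwa [(mem_iff σ).mp ⟨hσ, hσ0⟩]
  refine ⟨by simp, by simp, fun χ η => ?_⟩
  have hsum : (∑ σ : Fin r → ZMod 2, if χ σ = 1 ∧ η σ = 1 then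
      (if σ ∈ H ∧ σ ≠ 0 then (2 : ℤ) • v else 0) else 0) =
      if χ h = 1 ∧ η h = 1 then (2 : ℤ) • v else 0 := by
    rw [Finset.sum_eq_single h]
    · simp [hmem, hh]
    · intro σ _ hσ
      rw [if_neg (fun e => hσ ((mem_iff σ).mp e)), ite_self]
    · simp
  simp only [vanish_iff]
  rw [hsum, LinearMap.add_apply]
  have one_add_one : (1 : ZMod 2) + 1 = 0 := by decide
  rcases two (χ h) with h1 | h1 <;> rcases two (η h) with h2 | h2 <;>
    simp [h1, h2, one_add_one, two_smul]
end

section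
/- Let H ⊆ G be a subspace of dimension d + 2 for some integer d ≥ 0 and let v ∈ Λ. Define L : G^∨ → Λ by L_χ = 0 if χ vanishes identically on H and L_χ = 2^d · v otherwise, and define D : G → Λ by D_σ = v if σ ∈ H \ {0} and D_σ = 0 otherwise. Then the pair (L, D) satisfies the cover condition, i.e. (L, D) ∈ Z(G, Λ). -/
open scoped Classical in
/-- A linear form over `ZMod 2` that does not vanish on a finite subspace `H` takes the value `1`
on exactly half of `H`. -/
theorem two_mul_card_filter_eq_one {V : Type*} [AddCommGroup V] [Module (ZMod 2) V] [Fintype V]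
    (H : Submodule (ZMod 2) V) (χ : Module.Dual (ZMod 2) V) {τ : V} (hτ : τ ∈ H)
    (hχ : χ τ ≠ 0) :
    2 * (Finset.univ.filter fun σ : V => σ ∈ H ∧ χ σ = 1).card
      = 2 ^ Module.finrank (ZMod 2) H := by
  have hχ1 : χ τ = 1 := by
    have h1 : ∀ a : ZMod 2, a ≠ 0 → a = 1 := by decide
    exact h1 _ hχ
  have hswap : (Finset.univ.filter fun σ : V => σ ∈ H ∧ χ σ = 1).card
      = (Finset.univ.filter fun σ : V => σ ∈ H ∧ ¬ χ σ = 1).card := by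
    refine Finset.card_equiv (Equiv.addRight τ) fun σ => ?_
    have h2 : ∀ a : ZMod 2, a = 1 ↔ ¬ a + 1 = 1 := by decide
    simp [H.add_mem_iff_left hτ, hχ1, h2 (χ σ)]
  have hsplit := Finset.card_filter_add_card_filter_not
    (s := Finset.univ.filter fun σ : V => σ ∈ H) (fun σ : V => χ σ = 1)
  rw [Finset.filter_filter, Finset.filter_filter, ← hswap] at hsplit
  have hcard : (Finset.univ.filter fun σ : V => σ ∈ H).card
      = 2 ^ Module.finrank (ZMod 2) H := by
    rw [← Fintype.card_subtype]
    simpa using Module.card_eq_pow_finrank (K := ZMod 2) (V := H)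
  omega

open scoped Classical in
/-- Counting form of the pointwise identity `[a = 1] + [b = 1] = [a + b = 1] + 2 [a = b = 1]`. -/
theorem card_filter_add_card_filter_eq {V : Type*} [AddCommGroup V] [Module (ZMod 2) V]
    (s : Finset V) (χ η : Module.Dual (ZMod 2) V) :
    (s.filter fun σ => χ σ = 1).card + (s.filter fun σ => η σ = 1).card
      = (s.filter fun σ => (χ + η) σ = 1).card
        + 2 * (s.filter fun σ => χ σ = 1 ∧ η σ = 1).card := by
  simp only [Finset.card_filter, Finset.mul_sum, ← Finset.sum_add_distrib]
  refine Finset.sum_congr rfl fun σ _ => ?_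
  have h2 : ∀ a b : ZMod 2, ((if a = 1 then 1 else 0) + (if b = 1 then 1 else 0) : ℕ)
      = (if a + b = 1 then 1 else 0) + 2 * (if a = 1 ∧ b = 1 then 1 else 0) := by decide
  rw [LinearMap.add_apply]
  convert h2 (χ σ) (η σ)

open scoped Classical in
/-- for a subspace `H ⊆ G` of dimension `d + 2` and `v ∈ Λ`, the
elementary pair `L_χ = 0` if `χ|_H = 0`, `L_χ = 2^d • v` otherwise; `D_σ = v` for
`σ ∈ H \ {0}`, `D_σ = 0` otherwise, satisfies the cover condition. -/
theorem elementary_solution_dim_ge_two {r : ℕ} {Λ : Type*} [AddCommGroup Λ]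
    (H : Submodule (ZMod 2) (Fin r → ZMod 2)) (d : ℕ)
    (hH : Module.finrank (ZMod 2) H = d + 2) (v : Λ) :
    CoverCondition
      (fun χ : Module.Dual (ZMod 2) (Fin r → ZMod 2) =>
        if ∀ σ ∈ H, χ σ = 0 then (0 : Λ) else ((2 : ℤ) ^ d) • v)
      (fun σ : Fin r → ZMod 2 =>
        if σ ∈ H ∧ σ ≠ 0 then v else 0) := by
  refine ⟨by simp, by simp, fun χ η => ?_⟩
  let ℓ : Module.Dual (ZMod 2) (Fin r → ZMod 2) → ℕ :=
    fun χ => if ∀ σ ∈ H, χ σ = 0 then 0 else 2 ^ d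
  have hL : ∀ χ : Module.Dual (ZMod 2) (Fin r → ZMod 2),
      (if ∀ σ ∈ H, χ σ = 0 then (0 : Λ) else ((2 : ℤ) ^ d) • v) = ℓ χ • v := by
    intro χ
    by_cases h : ∀ σ ∈ H, χ σ = 0
    · simp only [ℓ, if_pos h, zero_smul]
    · simp only [ℓ, if_neg h]
      rw [← natCast_zsmul]
      push_cast
      rfl
  let s : Finset (Fin r → ZMod 2) := Finset.univ.filter fun σ => σ ∈ H
  have hℓ : ∀ χ : Module.Dual (ZMod 2) (Fin r → ZMod 2),
      (s.filter fun σ => χ σ = 1).card = 2 * ℓ χ := by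
    intro χ
    by_cases h : ∀ σ ∈ H, χ σ = 0
    · simp only [ℓ, if_pos h, mul_zero, Finset.card_eq_zero, Finset.filter_eq_empty_iff]
      intro σ hσ
      rw [h σ (Finset.mem_filter.mp hσ).2]
      decide
    · simp only [ℓ, if_neg h]
      push Not at h
      obtain ⟨τ, hτ, hχτ⟩ := h
      have hcard := two_mul_card_filter_eq_one H χ hτ hχτ
      rw [hH, pow_add] at hcard
      simp only [s, Finset.filter_filter]
      omega
  have hsum : (∑ σ : Fin r → ZMod 2,
      if χ σ = 1 ∧ η σ = 1 then (if σ ∈ H ∧ σ ≠ 0 then v else 0) else 0)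
      = (s.filter fun σ => χ σ = 1 ∧ η σ = 1).card • v := by
    rw [← Finset.sum_const, Finset.filter_filter, Finset.sum_filter]
    refine Finset.sum_congr rfl fun σ _ => ?_
    by_cases h0 : σ = 0
    · simp [h0]
    · by_cases hσ : σ ∈ H <;> simp [h0, hσ]
  have hcount : ℓ χ + ℓ η = ℓ (χ + η) + (s.filter fun σ => χ σ = 1 ∧ η σ = 1).card := by
    have h := card_filter_add_card_filter_eq s χ η
    rw [hℓ, hℓ, hℓ] at h
    omega
  simp only [hL]
  rw [← add_smul, hcount, add_smul, ← hsum]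
end

section
/- (Lemma 3.2) Assume r ≥ 4 (so dim G ≥ 4) and let H ⊊ G be a proper subspace. Let α : Λ → ℤ be a nonzero homomorphism of abelian groups, let N be a positive integer, and let D : H → Λ be any map with D_0 = 0. Then there exists a pair (L, D') ∈ Z(G, Λ) such that D' restricted to H equals D, and moreover: (a) α(L_χ − D'_σ) ≥ N for every χ ∈ G^∨ \ {0} and every σ ∈ G; (b) α(D'_σ) ≥ N for every σ ∈ G \ H. -/
/-- Solutions of the cover condition are closed under addition. -/
theorem CoverCondition.add {r : ℕ} {Λ : Type*} [AddCommGroup Λ]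
    {L L' : Module.Dual (ZMod 2) (Fin r → ZMod 2) → Λ} {D D' : (Fin r → ZMod 2) → Λ}
    (h : CoverCondition L D) (h' : CoverCondition L' D') :
    CoverCondition (L + L') (D + D') := by
  obtain ⟨hL, hD, hc⟩ := h
  obtain ⟨hL', hD', hc'⟩ := h'
  refine ⟨by simp [hL, hL'], by simp [hD, hD'], fun χ η => ?_⟩
  have key : ∀ σ, (if χ σ = 1 ∧ η σ = 1 then D σ + D' σ else 0) =
      (if χ σ = 1 ∧ η σ = 1 then D σ else 0) + (if χ σ = 1 ∧ η σ = 1 then D' σ else 0) := by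
    intro σ
    split_ifs <;> simp
  simp only [Pi.add_apply, key, Finset.sum_add_distrib]
  rw [add_add_add_comm, hc, hc', add_add_add_comm]

/-- Solutions of the cover condition are closed under finite sums. -/
theorem CoverCondition.sum {r : ℕ} {Λ ι : Type*} [AddCommGroup Λ] (s : Finset ι)
    {L : ι → Module.Dual (ZMod 2) (Fin r → ZMod 2) → Λ} {D : ι → (Fin r → ZMod 2) → Λ}
    (h : ∀ i, CoverCondition (L i) (D i)) :
    CoverCondition (∑ i ∈ s, L i) (∑ i ∈ s, D i) := by
  classical
  induction s using Finset.induction_on with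
  | empty => exact ⟨by simp, by simp, by simp⟩
  | insert a s ha ih =>
    rw [Finset.sum_insert ha, Finset.sum_insert ha]
    exact (h a).add ih

/-- Putting the same value on the three nonzero elements of a plane solves the cover condition. -/
theorem coverCondition_plane {r : ℕ} {Λ : Type*} [AddCommGroup Λ] (a b : Fin r → ZMod 2) (l : Λ)
    (h : l = 0 ∨ (a ≠ 0 ∧ b ≠ 0 ∧ a + b ≠ 0)) :
    CoverCondition (fun χ => if χ a = 1 ∨ χ b = 1 then l else 0)
      (fun σ => (if σ = a then l else 0) + (if σ = b then l else 0) +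
        (if σ = a + b then l else 0)) := by
  refine ⟨by simp, ?_, fun χ η => ?_⟩
  · rcases h with rfl | ⟨ha, hb, hab⟩
    · simp
    · simp [ha.symm, hb.symm, hab.symm]
  · have key : ∀ σ, (if χ σ = 1 ∧ η σ = 1 then ((if σ = a then l else 0) +
        (if σ = b then l else 0) + (if σ = a + b then l else 0)) else 0) =
        (if σ = a then (if χ a = 1 ∧ η a = 1 then l else 0) else 0) +
        (if σ = b then (if χ b = 1 ∧ η b = 1 then l else 0) else 0) +
        (if σ = a + b then (if χ (a + b) = 1 ∧ η (a + b) = 1 then l else 0) else 0) := by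
      intro σ
      by_cases h1 : σ = a <;> by_cases h2 : σ = b <;> by_cases h3 : σ = a + b <;>
        by_cases hc : χ σ = 1 ∧ η σ = 1 <;> simp_all <;> split_ifs <;> simp_all
    simp only [key, Finset.sum_add_distrib, Finset.sum_ite_eq', Finset.mem_univ, if_true,
      LinearMap.add_apply, map_add]
    have h01 : ∀ x : ZMod 2, x = 0 ∨ x = 1 := by decide
    have h11 : (1 + 1 : ZMod 2) = 0 := by decide
    rcases h01 (χ a) with h1 | h1 <;> rcases h01 (χ b) with h2 | h2 <;>
      rcases h01 (η a) with h3 | h3 <;> rcases h01 (η b) with h4 | h4 <;>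
      simp [h1, h2, h3, h4, h11]

/-- Twice any function vanishing at `0` solves the cover condition. -/
theorem coverCondition_two_nsmul {r : ℕ} {Λ : Type*} [AddCommGroup Λ]
    (f : (Fin r → ZMod 2) → Λ) (hf : f 0 = 0) :
    CoverCondition (fun χ => ∑ σ, if χ σ = 1 then f σ else 0) (fun σ => f σ + f σ) := by
  refine ⟨by simp, by simp [hf], fun χ η => ?_⟩
  simp only [← Finset.sum_add_distrib]
  refine Finset.sum_congr rfl fun σ _ => ?_
  have h01 : ∀ x : ZMod 2, x = 0 ∨ x = 1 := by decide
  have h11 : (1 + 1 : ZMod 2) = 0 := by decide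
  rcases h01 (χ σ) with h1 | h1 <;> rcases h01 (η σ) with h2 | h2 <;> simp [h1, h2, h11]

/-- A nonzero linear form on `(ℤ/2)^r` takes the value `1` on half of the space. -/
theorem two_mul_card_dual_eq_one {r : ℕ} {χ : Module.Dual (ZMod 2) (Fin r → ZMod 2)}
    (hχ : χ ≠ 0) : 2 * (Finset.univ.filter fun σ => χ σ = 1).card = 2 ^ r := by
  have h01 : ∀ x : ZMod 2, x = 0 ∨ x = 1 := by decide
  have hne : ∀ x : ZMod 2, x + 1 = 1 ↔ ¬ x = 1 := by decide
  obtain ⟨t, ht⟩ : ∃ t, χ t = 1 := by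
    by_contra! hc
    exact hχ (LinearMap.ext fun x => (h01 (χ x)).resolve_right (hc x))
  have hcard := Finset.card_filter_add_card_filter_not
    (s := (Finset.univ : Finset (Fin r → ZMod 2))) (fun σ => χ σ = 1)
  have heq : (Finset.univ.filter fun σ => χ σ = 1).card =
      (Finset.univ.filter fun σ => ¬ χ σ = 1).card := by
    refine Finset.card_equiv (Equiv.addRight t) fun σ => ?_
    simp only [Finset.mem_filter, Finset.mem_univ, true_and, Equiv.coe_addRight, map_add, ht, hne,
      not_not]
  have hu : (Finset.univ : Finset (Fin r → ZMod 2)).card = 2 ^ r := by simp [ZMod.card]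
  omega

/-- Two nonzero linear forms on `(ℤ/2)^r` are simultaneously `1` on at least a quarter of the
space. -/
theorem two_pow_le_four_mul_card_dual {r : ℕ}
    {χ η : Module.Dual (ZMod 2) (Fin r → ZMod 2)} (hχ : χ ≠ 0) (hη : η ≠ 0) :
    2 ^ r ≤ 4 * (Finset.univ.filter fun σ => χ σ = 1 ∧ η σ = 1).card := by
  by_cases h : χ + η = 0
  · have hχη : χ = η := by
      have hself : η + η = 0 := by
        rw [← two_smul (ZMod 2) η, show (2 : ZMod 2) = 0 by decide, zero_smul]
      exact add_right_cancel (h.trans hself.symm)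
    subst hχη
    have := two_mul_card_dual_eq_one hχ
    simp only [and_self]
    omega
  · have h1 := two_mul_card_dual_eq_one hχ
    have h2 := two_mul_card_dual_eq_one hη
    have h3 := two_mul_card_dual_eq_one h
    have hc := (coverCondition_two_nsmul (r := r) (Λ := ℤ) (fun σ => if σ = 0 then 0 else 1)
      (by simp)).2.2 χ η
    have key : ∀ φ : Module.Dual (ZMod 2) (Fin r → ZMod 2),
        (∑ σ, if φ σ = 1 then (if σ = 0 then (0 : ℤ) else 1) else 0) =
        (Finset.univ.filter fun σ => φ σ = 1).card := by
      intro φ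
      rw [Finset.card_filter]
      push_cast
      refine Finset.sum_congr rfl fun σ _ => ?_
      by_cases hs : σ = 0
      · simp [hs]
      · simp [hs]
    have key2 : (∑ σ, if χ σ = 1 ∧ η σ = 1 then
        ((if σ = 0 then (0 : ℤ) else 1) + (if σ = 0 then (0 : ℤ) else 1)) else 0) =
        2 * (Finset.univ.filter fun σ => χ σ = 1 ∧ η σ = 1).card := by
      rw [Finset.card_filter]
      push_cast
      rw [Finset.mul_sum]
      refine Finset.sum_congr rfl fun σ _ => ?_
      by_cases hs : σ = 0
      · simp [hs]
      · simp [hs]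
    simp only [key, key2] at hc
    omega

/-- Any function on a proper subspace vanishing at `0` extends to a solution of the cover
condition. -/
theorem exists_coverCondition_extension {r : ℕ} {Λ : Type*} [AddCommGroup Λ]
    (H : Submodule (ZMod 2) (Fin r → ZMod 2)) (hH : H ≠ ⊤) (D : H → Λ) (hD : D 0 = 0) :
    ∃ (L : Module.Dual (ZMod 2) (Fin r → ZMod 2) → Λ) (D' : (Fin r → ZMod 2) → Λ),
      CoverCondition L D' ∧ ∀ σ : H, D' σ = D σ := by
  classical
  obtain ⟨t, ht⟩ : ∃ t, t ∉ H := by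
    by_contra! hc
    exact hH (Submodule.eq_top_iff'.2 hc)
  refine ⟨_, _, CoverCondition.sum Finset.univ fun h : H =>
    coverCondition_plane (h : Fin r → ZMod 2) t (D h) ?_, fun σ => ?_⟩
  · by_cases h0 : h = 0
    · exact Or.inl (by rw [h0, hD])
    · refine Or.inr ⟨by simpa using h0, fun hc => ht (hc ▸ H.zero_mem), fun hc => ht ?_⟩
      rw [← H.add_mem_iff_right h.2, hc]
      exact H.zero_mem
  · have h1 : (σ : Fin r → ZMod 2) ≠ t := fun hc => ht (hc ▸ σ.2)
    have h2 : ∀ h : H, (σ : Fin r → ZMod 2) ≠ h + t := fun h hc =>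
      ht ((H.add_mem_iff_right h.2).1 (hc ▸ σ.2))
    simp [Finset.sum_apply, h1, h2, Subtype.ext_iff.symm]

/-- Lemma 3.2: assume `dim G ≥ 4` and let `H ⊊ G` be a proper subspace,
`α : Λ → ℤ` a nonzero homomorphism, `N` a positive integer, and `D : H → Λ` a map with
`D 0 = 0`.  Then there is a pair `(L, D')` satisfying the cover condition, with `D'`
extending `D`, such that `α (L χ - D' σ) ≥ N` for every `χ ≠ 0` and every `σ`, and
`α (D' σ) ≥ N` for every `σ ∉ H`. -/
theorem exists_extension_cover_condition_large {r : ℕ} (hr : 4 ≤ r)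
    {Λ : Type*} [AddCommGroup Λ]
    (H : Submodule (ZMod 2) (Fin r → ZMod 2)) (hH : H ≠ ⊤)
    (α : Λ →+ ℤ) (hα : α ≠ 0)
    (N : ℤ) (hN : 0 < N)
    (D : H → Λ) (hD : D 0 = 0) :
    ∃ (L : Module.Dual (ZMod 2) (Fin r → ZMod 2) → Λ)
      (D' : (Fin r → ZMod 2) → Λ),
      CoverCondition L D' ∧
      (∀ σ : H, D' σ = D σ) ∧
      (∀ χ : Module.Dual (ZMod 2) (Fin r → ZMod 2), χ ≠ 0 →
        ∀ σ : Fin r → ZMod 2, N ≤ α (L χ - D' σ)) ∧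
      (∀ σ : Fin r → ZMod 2, σ ∉ H → N ≤ α (D' σ)) := by
  classical
  obtain ⟨L, E, hLE, hE⟩ := exists_coverCondition_extension H hH D hD
  obtain ⟨l, hl⟩ : ∃ l, 0 < α l := by
    by_contra! hc
    refine hα (AddMonoidHom.ext fun x => le_antisymm (hc x) ?_)
    have := hc (-x)
    rw [map_neg] at this
    simpa using this
  have : Finite (Module.Dual (ZMod 2) (Fin r → ZMod 2)) := DFunLike.finite _
  obtain ⟨A, hA⟩ := Finite.exists_le (fun χ => -α (L χ))
  obtain ⟨B, hB⟩ := Finite.exists_le (fun σ => |α (E σ)|)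
  obtain ⟨m, hm⟩ : ∃ m : ℕ, N + |A| + B ≤ m := ⟨_, Int.self_le_toNat _⟩
  have hml : N + |A| + B ≤ α (m • l) := by
    rw [map_nsmul, nsmul_eq_mul]
    nlinarith
  set μ := m • l
  have hA' := le_abs_self A
  have hA0 := abs_nonneg A
  have hB0 : 0 ≤ B := (abs_nonneg _).trans (hB 0)
  refine ⟨_, _, hLE.add (coverCondition_two_nsmul (fun σ => if σ ∈ H then 0 else μ) (by simp)),
    fun σ => by simp [hE], fun χ hχ σ => ?_, fun σ hσ => ?_⟩
  · obtain ⟨η, hη, hHη⟩ := Submodule.exists_le_ker_of_lt_top H (lt_top_iff_ne_top.2 hH)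
    have hcard : 4 ≤ (Finset.univ.filter fun σ => χ σ = 1 ∧ η σ = 1).card := by
      have h1 := two_pow_le_four_mul_card_dual hχ hη
      have h2 : 2 ^ 4 ≤ 2 ^ r := Nat.pow_le_pow_right (by norm_num) hr
      omega
    have hsum : 4 * α μ ≤ ∑ σ, if χ σ = 1 then (if σ ∈ H then 0 else α μ) else 0 := by
      calc 4 * α μ ≤ (Finset.univ.filter fun σ => χ σ = 1 ∧ η σ = 1).card * α μ :=
            mul_le_mul_of_nonneg_right (by exact_mod_cast hcard) (by linarith)
        _ = ∑ σ, if χ σ = 1 ∧ η σ = 1 then α μ else 0 := by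
            rw [← Finset.sum_filter, Finset.sum_const, nsmul_eq_mul]
        _ ≤ _ := by
            refine Finset.sum_le_sum fun x _ => ?_
            by_cases hx : x ∈ H
            · have : η x = 0 := hHη hx
              simp [hx, this]
            · by_cases h1 : χ x = 1 <;> by_cases h2 : η x = 1 <;> simp [hx, h1, h2]
              linarith
    have h1 := hA χ
    have h2 := (le_abs_self _).trans (hB σ)
    simp only [Pi.add_apply, map_sub, map_add, map_sum, apply_ite α, map_zero]
    split_ifs <;> linarith
  · have h2 := (neg_abs_le (α (E σ)))
    have h3 := hB σ
    simp only [Pi.add_apply, hσ, if_false, map_add]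
    linarith
end

section
/- Let A be a multiplicatively written abelian group and let α : G^∨ × G^∨ → A be a map satisfying α_{χ,η} = α_{η,χ}, α_{χ,0} = 1, and α_{χ,η} · α_{χ+η,μ} = α_{χ,μ} · α_{χ+μ,η} for all χ, η, μ ∈ G^∨. Assume that for every χ ∈ G^∨ the element α_{χ,χ} admits a square root in A. Then there exists a family of elements g_χ ∈ A, indexed by χ ∈ G^∨, with g_0 = 1 and g_χ · g_η = g_{χ+η} · α_{χ,η} for all χ, η ∈ G^∨. -/
/-- The underlying type of the extension of `V` by `A` attached to a symmetric 2-cocycle. -/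
@[ext]
structure CocycleExtension (A V : Type*) where
  /-- the component in the kernel of the extension -/
  fiber : A
  /-- the component in the quotient of the extension -/
  base : V

/-- The commutative group structure on the extension defined by a normalized symmetric
2-cocycle, with `(a, χ) + (b, η) = (a b α χ η, χ + η)`. -/
abbrev CocycleExtension.addCommGroup {A V : Type*} [CommGroup A] [AddCommGroup V]
    (α : V → V → A) (hsymm : ∀ χ η, α χ η = α η χ) (hone : ∀ χ, α χ 0 = 1)
    (hcocycle : ∀ χ η μ, α χ η * α (χ + η) μ = α χ μ * α (χ + μ) η) :
    AddCommGroup (CocycleExtension A V) :=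
  letI : Add (CocycleExtension A V) :=
    ⟨fun x y => ⟨x.fiber * y.fiber * α x.base y.base, x.base + y.base⟩⟩
  letI : Zero (CocycleExtension A V) := ⟨⟨1, 0⟩⟩
  letI : Neg (CocycleExtension A V) :=
    ⟨fun x => ⟨x.fiber⁻¹ * (α x.base (-x.base))⁻¹, -x.base⟩⟩
  { nsmul := nsmulRec
    zsmul := zsmulRec
    add_assoc := by
      rintro ⟨a, χ⟩ ⟨b, η⟩ ⟨c, μ⟩
      refine CocycleExtension.ext ?_ (add_assoc χ η μ)
      change a * b * α χ η * c * α (χ + η) μ = a * (b * c * α η μ) * α χ (η + μ)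
      have h : α χ η * α (χ + η) μ = α η μ * α χ (η + μ) := by
        rw [hsymm χ η, add_comm χ η, hcocycle η χ μ, hsymm χ]
      calc a * b * α χ η * c * α (χ + η) μ = a * b * c * (α χ η * α (χ + η) μ) := by
            simp only [mul_assoc, mul_left_comm]
        _ = a * (b * c * α η μ) * α χ (η + μ) := by rw [h]; simp only [mul_assoc]
    add_comm := by
      rintro ⟨a, χ⟩ ⟨b, η⟩
      refine CocycleExtension.ext ?_ (add_comm χ η)
      change a * b * α χ η = b * a * α η χ
      rw [mul_comm a b, hsymm]
    zero_add := by
      rintro ⟨a, χ⟩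
      refine CocycleExtension.ext ?_ (zero_add χ)
      change 1 * a * α 0 χ = a
      rw [hsymm, hone, one_mul, mul_one]
    add_zero := by
      rintro ⟨a, χ⟩
      refine CocycleExtension.ext ?_ (add_zero χ)
      change a * 1 * α χ 0 = a
      rw [hone, mul_one, mul_one]
    neg_add_cancel := by
      rintro ⟨a, χ⟩
      refine CocycleExtension.ext ?_ (neg_add_cancel χ)
      change a⁻¹ * (α χ (-χ))⁻¹ * a * α (-χ) χ = 1
      rw [hsymm (-χ) χ, mul_right_comm a⁻¹, inv_mul_cancel, one_mul, inv_mul_cancel] }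

/-- A normalized symmetric 2-cocycle on a vector space over `ZMod 2` whose diagonal values are
squares is a coboundary: the 2-torsion of the associated extension surjects onto the vector
space, and a linear section of this surjection gives the cochain. -/
theorem exists_cochain_of_symmetric_cocycle_of_module {V A : Type*} [AddCommGroup V]
    [Module (ZMod 2) V] [CommGroup A] (α : V → V → A)
    (hsymm : ∀ χ η, α χ η = α η χ) (hone : ∀ χ, α χ 0 = 1)
    (hcocycle : ∀ χ η μ, α χ η * α (χ + η) μ = α χ μ * α (χ + μ) η)
    (hsq : ∀ χ, ∃ s : A, s ^ 2 = α χ χ) :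
    ∃ g : V → A, g 0 = 1 ∧ ∀ χ η, g χ * g η = g (χ + η) * α χ η := by
  let _ := CocycleExtension.addCommGroup α hsymm hone hcocycle
  let proj : CocycleExtension A V →+ V :=
    { toFun := CocycleExtension.base, map_zero' := rfl, map_add' := fun _ _ => rfl }
  let T : AddSubgroup (CocycleExtension A V) := (nsmulAddMonoidHom 2).ker
  let _ : Module (ZMod 2) T := AddCommGroup.zmodModule fun x => Subtype.ext x.2
  let p : T →ₗ[ZMod 2] V := (proj.comp T.subtype).toZModLinearMap 2
  have hp : Function.Surjective p := by
    intro χ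
    obtain ⟨s, hs⟩ := hsq χ
    refine ⟨⟨⟨s⁻¹, χ⟩, ?_⟩, rfl⟩
    change 2 • (⟨s⁻¹, χ⟩ : CocycleExtension A V) = 0
    rw [two_nsmul]
    refine CocycleExtension.ext ?_ (ZModModule.add_self χ)
    change s⁻¹ * s⁻¹ * α χ χ = 1
    rw [← hs, ← pow_two, ← mul_pow, inv_mul_cancel, one_pow]
  obtain ⟨f, hf⟩ := p.exists_rightInverse_of_surjective (LinearMap.range_eq_top.2 hp)
  have hbase (χ : V) : (f χ).1.base = χ := LinearMap.congr_fun hf χ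
  refine ⟨fun χ => (f χ).1.fiber⁻¹, ?_, fun χ η => ?_⟩
  · simp only [map_zero]
    exact inv_one
  · have h : (f (χ + η)).1.fiber = (f χ).1.fiber * (f η).1.fiber * α χ η := by
      rw [map_add]
      change (f χ).1.fiber * (f η).1.fiber * α (f χ).1.base (f η).1.base = _
      rw [hbase, hbase]
    simp only [h, mul_inv, inv_mul_cancel_right]


/-- let `A` be a multiplicative abelian group and
`α : G^∨ × G^∨ → A` (with `G = (ℤ/2)^r` and `G^∨` its dual) a map satisfying
`α_{χ,η} = α_{η,χ}`, `α_{χ,0} = 1` and `α_{χ,η} α_{χ+η,μ} = α_{χ,μ} α_{χ+μ,η}`.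
If every `α_{χ,χ}` has a square root in `A`, then there are elements `g_χ ∈ A` with
`g_0 = 1` and `g_χ g_η = g_{χ+η} α_{χ,η}` for all `χ, η`. -/
theorem exists_cochain_of_symmetric_cocycle {r : ℕ} {A : Type*} [CommGroup A]
    (α : Module.Dual (ZMod 2) (Fin r → ZMod 2) →
         Module.Dual (ZMod 2) (Fin r → ZMod 2) → A)
    (hsymm : ∀ χ η, α χ η = α η χ)
    (hone : ∀ χ, α χ 0 = 1)
    (hcocycle : ∀ χ η μ, α χ η * α (χ + η) μ = α χ μ * α (χ + μ) η)
    (hsq : ∀ χ, ∃ s : A, s ^ 2 = α χ χ) :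
    ∃ g : Module.Dual (ZMod 2) (Fin r → ZMod 2) → A,
      g 0 = 1 ∧ ∀ χ η, g χ * g η = g (χ + η) * α χ η :=
  exists_cochain_of_symmetric_cocycle_of_module α hsymm hone hcocycle hsq
end

section
/- Let c ≥ 1 and a ≥ 2c − 1 be integers and let V ⊆ S_c be a vector subspace that is base point free over ℙ¹, i.e. for every (p, q) ∈ ℂ² \ {(0,0)} there exists f ∈ V with f(p, q) ≠ 0. Then the multiplication map V ⊗ S_{a−c} → S_a is surjective; equivalently, every homogeneous polynomial of degree a in ℂ[x, y] is a finite linear combination of products f · g with f ∈ V and g ∈ S_{a−c}. -/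
open MvPolynomial

/-- Evaluating the degree-`n` homogenization at the point at infinity extracts the `n`-th
coefficient. -/
lemma Polynomial.eval_one_zero_homogenize {R : Type*} [CommSemiring R] (p : Polynomial R) (n : ℕ) :
    MvPolynomial.eval ![1, 0] (p.homogenize n) = p.coeff n := by
  rw [Polynomial.homogenize, map_sum, Finset.sum_eq_single (n, 0)]
  · simp [MvPolynomial.eval_monomial, Finsupp.prod_fintype, Fin.prod_univ_two]
  · rintro ⟨k, l⟩ hkl hne
    have hl : l ≠ 0 := by
      rintro rfl
      simp_all
    simp [MvPolynomial.eval_monomial, Finsupp.prod_fintype, Fin.prod_univ_two, hl]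
  · simp

/-- Setting the second variable to `1` in a form of degree `n` gives a polynomial of degree at
most `n`. -/
lemma MvPolynomial.IsHomogeneous.natDegree_aeval_X_one_le {R : Type*} [CommSemiring R]
    {F : MvPolynomial (Fin 2) R} {n : ℕ} (hF : F.IsHomogeneous n) :
    (MvPolynomial.aeval ![Polynomial.X, (1 : Polynomial R)] F).natDegree ≤ n := by
  nontriviality R
  have h := aeval_natDegree_le F hF.totalDegree_le ![Polynomial.X, (1 : Polynomial R)] (n := 1)
    (by intro i; fin_cases i <;> simp)
  simpa using h

/-- A form in two variables is determined by its dehomogenization. -/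
lemma MvPolynomial.IsHomogeneous.eq_of_aeval_X_one_eq {R : Type*} [CommSemiring R]
    {F G : MvPolynomial (Fin 2) R} {n : ℕ} (hF : F.IsHomogeneous n) (hG : G.IsHomogeneous n)
    (h : MvPolynomial.aeval ![Polynomial.X, (1 : Polynomial R)] F =
      MvPolynomial.aeval ![Polynomial.X, 1] G) : F = G := by
  rw [← Polynomial.homogenize_eq_of_isHomogeneous hF h,
    Polynomial.homogenize_eq_of_isHomogeneous hG rfl]

/-- Evaluating the dehomogenization at `z` is evaluating the form at `(z, 1)`. -/
lemma MvPolynomial.eval_aeval_X_one {R : Type*} [CommSemiring R]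
    (F : MvPolynomial (Fin 2) R) (z : R) :
    (MvPolynomial.aeval ![Polynomial.X, (1 : Polynomial R)] F).eval z = eval ![z, 1] F := by
  induction F using MvPolynomial.induction_on with
  | C r => simp
  | add p q hp hq => simp [hp, hq]
  | mul_X p i hp => fin_cases i <;> simp [hp]

/-- Over an algebraically closed field, polynomials without a common root generate the unit
ideal. -/
lemma Polynomial.ideal_span_eq_top_of_no_common_root {k : Type*} [Field k] [IsAlgClosed k]
    {s : Set (Polynomial k)} (hs : ∀ z : k, ∃ p ∈ s, p.eval z ≠ 0) : Ideal.span s = ⊤ := by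
  obtain ⟨d, hd⟩ := (IsPrincipalIdealRing.principal (Ideal.span s)).principal
  rw [hd, Ideal.submodule_span_eq, Ideal.span_singleton_eq_top]
  by_contra hu
  have hroot : ∃ z, d.IsRoot z := by
    by_cases h0 : d = 0
    · exact ⟨0, by simp [h0]⟩
    · exact IsAlgClosed.exists_root d (fun h => hu (isUnit_iff_degree_eq_zero.2 h))
  obtain ⟨z, hz⟩ := hroot
  obtain ⟨p, hp, hpz⟩ := hs z
  have hmem : p ∈ Ideal.span {d} := by
    rw [← Ideal.submodule_span_eq, ← hd]
    exact Ideal.subset_span hp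
  exact hpz (hz.dvd (Ideal.mem_span_singleton.1 hmem))

/-- Modulo a member of `V` of exact degree `c`, every element of the ideal generated by the
dehomogenization of `V` comes from a combination of products of degree `a`. -/
lemma exists_dehomogenization_add_mul {k : Type*} [Field k] {c a : ℕ} (hc : 1 ≤ c)
    (ha : 2 * c - 1 ≤ a) (V : Submodule k (MvPolynomial (Fin 2) k))
    {f : Polynomial k} (hf : f.natDegree = c) {q : Polynomial k}
    (hq : q ∈ Ideal.span (MvPolynomial.aeval ![Polynomial.X, (1 : Polynomial k)] ''
      (V : Set (MvPolynomial (Fin 2) k)))) :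
    ∃ T ∈ Submodule.span k {h : MvPolynomial (Fin 2) k |
        ∃ f ∈ V, ∃ g ∈ homogeneousSubmodule (Fin 2) k (a - c), h = f * g},
      ∃ u : Polynomial k, q = aeval ![Polynomial.X, (1 : Polynomial k)] T + f * u := by
  induction hq using Submodule.closure_induction with
  | zero => exact ⟨0, zero_mem _, 0, by simp⟩
  | add p q _ _ hp hq =>
    obtain ⟨T, hT, u, rfl⟩ := hp
    obtain ⟨T', hT', u', rfl⟩ := hq
    exact ⟨T + T', add_mem hT hT', u + u', by rw [map_add]; ring⟩
  | smul_mem r p hp =>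
    obtain ⟨G, hG, rfl⟩ := hp
    have hr : (r % f).natDegree ≤ a - c := by
      have := Polynomial.natDegree_mod_lt r (q := f) (by omega)
      omega
    refine ⟨G * (r % f).homogenize (a - c), Submodule.subset_span ⟨G, hG, _,
      Polynomial.isHomogeneous_homogenize _, rfl⟩,
      (r / f) * aeval ![Polynomial.X, (1 : Polynomial k)] G, ?_⟩
    rw [map_mul, Polynomial.aeval_homogenize_X_one _ hr, smul_eq_mul]
    nth_rw 1 [← EuclideanDomain.div_add_mod r f]
    ring

/-- let `c ≥ 1`, `a ≥ 2c - 1` and let `V ⊆ S_c` be a base point free (over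
`ℙ¹`) subspace of the homogeneous polynomials of degree `c` in `ℂ[x,y]`.  Then the
multiplication map `V ⊗ S_{a-c} → S_a` is surjective: every homogeneous polynomial of
degree `a` lies in the span of the products `f * g` with `f ∈ V`, `g ∈ S_{a-c}`. -/
theorem basepoint_free_mul_surjective (c a : ℕ) (hc : 1 ≤ c) (ha : 2 * c - 1 ≤ a)
    (V : Submodule ℂ (MvPolynomial (Fin 2) ℂ))
    (hV : V ≤ homogeneousSubmodule (Fin 2) ℂ c)
    (hbpf : ∀ p q : ℂ, (p, q) ≠ (0, 0) →
      ∃ f ∈ V, MvPolynomial.eval ![p, q] f ≠ 0) :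
    homogeneousSubmodule (Fin 2) ℂ a ≤
      Submodule.span ℂ
        {h : MvPolynomial (Fin 2) ℂ |
          ∃ f ∈ V, ∃ g ∈ homogeneousSubmodule (Fin 2) ℂ (a - c), h = f * g} := by
  have hca : c + (a - c) = a := by omega
  intro F hF
  rw [mem_homogeneousSubmodule] at hF
  obtain ⟨f, hfV, hf⟩ := hbpf 1 0 (by simp)
  have hfc : f.IsHomogeneous c := hV hfV
  set f₁ := aeval ![Polynomial.X, (1 : Polynomial ℂ)] f with hf₁
  have hcoeff : f₁.coeff c ≠ 0 := by
    rwa [← Polynomial.eval_one_zero_homogenize,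
      Polynomial.homogenize_eq_of_isHomogeneous hfc hf₁.symm]
  have hdeg : f₁.natDegree = c :=
    le_antisymm hfc.natDegree_aeval_X_one_le (Polynomial.le_natDegree_of_ne_zero hcoeff)
  have hf₁0 : f₁ ≠ 0 := by
    rintro h
    simp [h] at hcoeff
  have htop := Polynomial.ideal_span_eq_top_of_no_common_root
    (s := aeval ![Polynomial.X, (1 : Polynomial ℂ)] '' (V : Set (MvPolynomial (Fin 2) ℂ)))
    (fun z => by
      obtain ⟨g, hg, hgz⟩ := hbpf z 1 (by simp)
      exact ⟨_, ⟨g, hg, rfl⟩, by rwa [eval_aeval_X_one]⟩)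
  obtain ⟨T, hT, u, hu⟩ := exists_dehomogenization_add_mul hc ha V hdeg
    (q := aeval ![Polynomial.X, (1 : Polynomial ℂ)] F) (htop ▸ Submodule.mem_top)
  have hTa : T.IsHomogeneous a := by
    rw [← mem_homogeneousSubmodule]
    refine Submodule.span_le.2 ?_ hT
    rintro _ ⟨g, hg, g', hg', rfl⟩
    exact hca ▸ IsHomogeneous.mul (hV hg) hg'
  have hudeg : u.natDegree ≤ a - c := by
    by_cases hu0 : u = 0
    · simp [hu0]
    have h : (f₁ * u).natDegree ≤ a := by
      rw [← sub_eq_of_eq_add' hu, ← map_sub]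
      exact (hF.sub hTa).natDegree_aeval_X_one_le
    rw [Polynomial.natDegree_mul hf₁0 hu0] at h
    omega
  have hfu : (f * u.homogenize (a - c)).IsHomogeneous a := by
    have := hfc.mul (Polynomial.isHomogeneous_homogenize (n := a - c) u)
    rwa [hca] at this
  have hFeq : F = T + f * u.homogenize (a - c) :=
    hF.eq_of_aeval_X_one_eq (hTa.add hfu) (by
      rw [hu, map_add, map_mul, Polynomial.aeval_homogenize_X_one _ hudeg])
  rw [hFeq]
  exact add_mem hT (Submodule.subset_span
    ⟨f, hfV, _, Polynomial.isHomogeneous_homogenize u, rfl⟩)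
end

section
/- (lattice-theoretic content of Lemma 4.11) Let n ≥ 2 and let B be the symmetric bilinear form on ℤⁿ given by the matrix M with M_{ii} = −2 for all i, M_{i,i+1} = M_{i+1,i} = 1 for 1 ≤ i ≤ n−1, and all other entries 0 (the intersection form on the second homology of the Milnor fibre of a smoothing of a rational double point of type A_n). Let Q be the bilinear form on ℤ³ given by the diagonal matrix diag(0, −1, −1) (the intersection form on the second homology of the blow-up of ℂ × ℙ¹ at two points). Then there is no additive map φ : ℤⁿ → ℤ³ satisfying B(x, y) = Q(φ(x), φ(y)) for all x, y ∈ ℤⁿ. -/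
/-- The `A_n` intersection matrix: `-2` on the diagonal, `1` on the two off-diagonals,
`0` elsewhere. -/
def AnMatrix (n : ℕ) : Matrix (Fin n) (Fin n) ℤ :=
  fun i j =>
    if i = j then -2
    else if (i : ℕ) + 1 = (j : ℕ) ∨ (j : ℕ) + 1 = (i : ℕ) then 1
    else 0

/-- The `A_n` intersection form on `ℤⁿ` (intersection form on the second homology of
the Milnor fibre of a smoothing of a rational double point of type `A_n`). -/
def AnForm (n : ℕ) (x y : Fin n → ℤ) : ℤ :=
  ∑ i, ∑ j, x i * AnMatrix n i j * y j

/-- The bilinear form on `ℤ³` given by the diagonal matrix `diag(0, -1, -1)`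
(intersection form on the second homology of the blow-up of `ℂ × ℙ¹` at two points). -/
def BlowupForm (u v : Fin 3 → ℤ) : ℤ :=
  0 * (u 0 * v 0) + (-1) * (u 1 * v 1) + (-1) * (u 2 * v 2)

theorem AnForm_single (n : ℕ) (i j : Fin n) :
    AnForm n (Pi.single i 1) (Pi.single j 1) = AnMatrix n i j := by
  simp [AnForm, Pi.single_apply]

/-- Integer vectors of square length two in the plane have even inner product. -/
theorem inner_ne_neg_one_of_sq_add_sq_eq_two {a b c d : ℤ}
    (hab : a * a + b * b = 2) (hcd : c * c + d * d = 2) : a * c + b * d ≠ -1 := by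
  have ha : a ≤ 1 := by nlinarith
  have ha' : -1 ≤ a := by nlinarith
  have hb : b ≤ 1 := by nlinarith
  have hb' : -1 ≤ b := by nlinarith
  have hc : c ≤ 1 := by nlinarith
  have hc' : -1 ≤ c := by nlinarith
  have hd : d ≤ 1 := by nlinarith
  have hd' : -1 ≤ d := by nlinarith
  interval_cases a <;> interval_cases b <;> simp at hab <;>
    interval_cases c <;> interval_cases d <;> simp at hcd ⊢

/-- lattice-theoretic content of Lemma 4.11: for `n ≥ 2` there is no
additive map `φ : ℤⁿ → ℤ³` carrying the `A_n` intersection form to the form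
`diag(0, -1, -1)`. -/
theorem no_isometry_An_into_blowup (n : ℕ) (hn : 2 ≤ n) :
    ¬ ∃ φ : (Fin n → ℤ) →+ (Fin 3 → ℤ),
      ∀ x y : Fin n → ℤ, AnForm n x y = BlowupForm (φ x) (φ y) := by
  rintro ⟨φ, hφ⟩
  let i : Fin n := ⟨0, by omega⟩
  let j : Fin n := ⟨1, by omega⟩
  have hii := hφ (Pi.single i 1) (Pi.single i 1)
  have hjj := hφ (Pi.single j 1) (Pi.single j 1)
  have hij := hφ (Pi.single i 1) (Pi.single j 1)
  have mii : AnMatrix n i i = -2 := by simp [AnMatrix]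
  have mjj : AnMatrix n j j = -2 := by simp [AnMatrix]
  have mij : AnMatrix n i j = 1 := by simp [AnMatrix, i, j]
  rw [AnForm_single, mii, BlowupForm] at hii
  rw [AnForm_single, mjj, BlowupForm] at hjj
  rw [AnForm_single, mij, BlowupForm] at hij
  exact inner_ne_neg_one_of_sq_add_sq_eq_two (by linarith) (by linarith)
    (by linarith : φ (Pi.single i 1) 1 * φ (Pi.single j 1) 1 +
      φ (Pi.single i 1) 2 * φ (Pi.single j 1) 2 = -1)
end
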